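/- Let K, J ≥ 1, let a : Fin K → Fin J → ℝ, let π : Fin J → ℝ with π j ≥ 0 and ∑_j π j = 1, let w : Fin K → ℝ with w k ≥ 0 and ∑_k w k = 1, and let β, r ∈ (0,1]. For each k let g_k = max{ (1/β) ∑_j u_j · a k j : 0 ≤ u_j ≤ π j, ∑_j u_j = β } be the β-average of scenario values of criterion k, and let h = max{ (1/r) ∑_k λ_k · g_k : 0 ≤ λ_k ≤ w k, ∑_k λ_k = r } be the r-OWA of the β-averages. Then h equals the optimal value of the single-level linear program: minimize z + ∑_k (w k / r) · v_k over z ∈ ℝ, v : Fin K → ℝ, z' : Fin K → ℝ, y : Fin K → Fin J → ℝ subject to v_k ≥ 0, y_{kj} ≥ 0, z + v_k ≥ z'_k + ∑_j (π j / β) · y_{kj} for all k, and z'_k + y_{kj} ≥ a k j for all k, j; moreover this minimum is attained. -/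

import Mathlib

/-- The feasible values of the maximization problem defining the `β`-average of `x` under the
weights `p`. -/
def tailAverageValues {ι : Type*} [Fintype ι] (p x : ι → ℝ) (β : ℝ) : Set ℝ :=
  {s : ℝ | ∃ u : ι → ℝ, (∀ i, 0 ≤ u i ∧ u i ≤ p i) ∧ (∑ i, u i = β) ∧
    s = (1 / β) * ∑ i, u i * x i}

/-- Every upper-tail mass `β` is cut out by a quantile `t`. -/
theorem exists_upper_quantile {ι : Type*} [Fintype ι] [Nonempty ι] (p x : ι → ℝ) {β : ℝ}
    (hβ0 : 0 ≤ β) (hβ1 : β ≤ ∑ i, p i) :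
    ∃ t : ℝ, (∑ i with t < x i, p i) ≤ β ∧ β ≤ ∑ i with t ≤ x i, p i := by
  obtain ⟨m, hm⟩ := Finite.exists_min x
  have hne : (Finset.univ.filter fun i => β ≤ ∑ j with x i ≤ x j, p j).Nonempty := by
    refine ⟨m, ?_⟩
    simpa [hm] using hβ1
  obtain ⟨i, hi, hmax⟩ := Finset.exists_max_image _ x hne
  refine ⟨x i, ?_, (Finset.mem_filter.1 hi).2⟩
  by_contra! hlt
  have hne' : (Finset.univ.filter fun j => x i < x j).Nonempty := by
    rw [Finset.nonempty_iff_ne_empty]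
    intro he
    rw [he, Finset.sum_empty] at hlt
    linarith
  obtain ⟨j, hj, hmin⟩ := Finset.exists_min_image _ x hne'
  have hij : x i < x j := (Finset.mem_filter.1 hj).2
  have hset : (Finset.univ.filter fun l => x j ≤ x l) = Finset.univ.filter fun l => x i < x l := by
    ext l
    simp only [Finset.mem_filter, Finset.mem_univ, true_and]
    exact ⟨fun h => hij.trans_le h, fun h => hmin l (by simpa using h)⟩
  have := hmax j (by simpa [hset] using hlt.le)
  linarith

/-- A primal-dual pair satisfying complementary slackness. -/
theorem exists_complementary_pair {ι : Type*} [Fintype ι] [Nonempty ι] (p x : ι → ℝ) {β : ℝ}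
    (hp : ∀ i, 0 ≤ p i) (hβ0 : 0 ≤ β) (hβ1 : β ≤ ∑ i, p i) :
    ∃ (t : ℝ) (u : ι → ℝ), (∀ i, 0 ≤ u i ∧ u i ≤ p i) ∧ (∑ i, u i = β) ∧
      ∀ i, u i * (x i - t) = p i * max (x i - t) 0 := by
  obtain ⟨t, hA, hAB⟩ := exists_upper_quantile p x hβ0 hβ1
  have hsplit : ∑ i with t ≤ x i, p i = (∑ i with t < x i, p i) + ∑ i with x i = t, p i := by
    simp only [Finset.sum_filter, ← Finset.sum_add_distrib]
    refine Finset.sum_congr rfl fun i _ => ?_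
    rcases lt_trichotomy t (x i) with h | h | h
    · simp [h, h.le, h.ne']
    · simp [h]
    · simp [h.not_ge, h.not_gt, h.ne]
  rw [hsplit] at hAB
  set A := ∑ i with t < x i, p i with hAdef
  set B := ∑ i with x i = t, p i with hBdef
  have hB : 0 ≤ B := Finset.sum_nonneg fun i _ => hp i
  obtain ⟨θ, hθ0, hθ1, hθ⟩ : ∃ θ : ℝ, 0 ≤ θ ∧ θ ≤ 1 ∧ A + θ * B = β := by
    rcases hB.eq_or_lt with h | h
    · exact ⟨0, le_rfl, zero_le_one, by linarith⟩
    · refine ⟨(β - A) / B, div_nonneg (by linarith) hB, (div_le_one h).2 (by linarith), ?_⟩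
      rw [div_mul_cancel₀ _ h.ne']
      ring
  refine ⟨t, fun i => (if t < x i then p i else 0) + θ * (if x i = t then p i else 0), ?_, ?_, ?_⟩
  · intro i
    have h1 := mul_nonneg hθ0 (hp i)
    have h2 := mul_le_of_le_one_left (hp i) hθ1
    have h3 := hp i
    rcases lt_trichotomy t (x i) with h | h | h
    · simp [h, h.ne', h3]
    · simp [h, h1, h2]
    · simp [h.not_gt, h.ne, h3]
  · rw [Finset.sum_add_distrib, ← Finset.mul_sum, ← Finset.sum_filter, ← Finset.sum_filter, hθ]
  · intro i
    rcases lt_trichotomy t (x i) with h | h | h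
    · simp [h, h.ne', h.le]
    · simp [h]
    · simp [h.not_gt, h.ne, h.le]

/-- Weak duality for the `β`-average. -/
theorem tailAverageValues_le {ι : Type*} [Fintype ι] {p x y : ι → ℝ} {β t s : ℝ} (hβ : 0 < β)
    (hs : s ∈ tailAverageValues p x β) (hy : ∀ i, 0 ≤ y i) (hxy : ∀ i, x i ≤ t + y i) :
    s ≤ t + ∑ i, (p i / β) * y i := by
  obtain ⟨u, hu, hsum, rfl⟩ := hs
  have key : ∑ i, u i * x i ≤ β * t + ∑ i, p i * y i := by
    rw [← hsum, Finset.sum_mul, ← Finset.sum_add_distrib]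
    refine Finset.sum_le_sum fun i _ => ?_
    have h1 := mul_le_mul_of_nonneg_left (hxy i) (hu i).1
    have h2 := mul_le_mul_of_nonneg_right (hu i).2 (hy i)
    linarith
  have hdiv : ∑ i, (p i / β) * y i = (1 / β) * ∑ i, p i * y i := by
    rw [Finset.mul_sum]
    exact Finset.sum_congr rfl fun i _ => by ring
  have h3 := mul_le_mul_of_nonneg_left key (one_div_pos.2 hβ).le
  have h4 : (1 / β) * (β * t) = t := by field_simp
  rw [hdiv]
  linarith

/-- Strong duality for the `β`-average: the maximum is attained and has the Rockafellar-Uryasev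
form. -/
theorem exists_isGreatest_tailAverageValues {ι : Type*} [Fintype ι] [Nonempty ι] (p x : ι → ℝ)
    {β : ℝ} (hp : ∀ i, 0 ≤ p i) (hβ0 : 0 < β) (hβ1 : β ≤ ∑ i, p i) :
    ∃ t : ℝ, IsGreatest (tailAverageValues p x β)
      (t + ∑ i, (p i / β) * max (x i - t) 0) := by
  obtain ⟨t, u, hu, hsum, hcomp⟩ := exists_complementary_pair p x hp hβ0.le hβ1
  refine ⟨t, ⟨u, hu, hsum, ?_⟩, fun s hs => tailAverageValues_le hβ0 hs
    (fun i => le_max_right _ _) fun i => ?_⟩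
  · have h1 : ∑ i, u i * x i = β * t + ∑ i, p i * max (x i - t) 0 := by
      rw [← hsum, Finset.sum_mul, ← Finset.sum_add_distrib]
      exact Finset.sum_congr rfl fun i _ => by rw [← hcomp]; ring
    have h2 : ∑ i, (p i / β) * max (x i - t) 0 = (1 / β) * ∑ i, p i * max (x i - t) 0 := by
      rw [Finset.mul_sum]
      exact Finset.sum_congr rfl fun i _ => by ring
    rw [h1, h2]
    field_simp
  · linarith [le_max_left (x i - t) 0]


/-- The r-OWA of the β-averages equals the optimal value of the single-level linear program
proposed in the paper, and this minimum is attained. -/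
theorem rOWA_of_betaAverages_eq_LP
    (K J : ℕ) (hK : 1 ≤ K) (hJ : 1 ≤ J)
    (a : Fin K → Fin J → ℝ)
    (pr : Fin J → ℝ) (hpr0 : ∀ j, 0 ≤ pr j) (hpr1 : ∑ j, pr j = 1)
    (w : Fin K → ℝ) (hw0 : ∀ k, 0 ≤ w k) (hw1 : ∑ k, w k = 1)
    (β r : ℝ) (hβ0 : 0 < β) (hβ1 : β ≤ 1) (hr0 : 0 < r) (hr1 : r ≤ 1)
    (gk : Fin K → ℝ)
    (hgk : gk = fun k => sSup {s : ℝ | ∃ u : Fin J → ℝ,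
      (∀ j, 0 ≤ u j ∧ u j ≤ pr j) ∧ (∑ j, u j = β) ∧
      s = (1 / β) * ∑ j, u j * a k j})
    (h : ℝ)
    (hh : h = sSup {s : ℝ | ∃ lam : Fin K → ℝ,
      (∀ k, 0 ≤ lam k ∧ lam k ≤ w k) ∧ (∑ k, lam k = r) ∧
      s = (1 / r) * ∑ k, lam k * gk k}) :
    IsLeast
      {t : ℝ | ∃ (z : ℝ) (v : Fin K → ℝ) (z' : Fin K → ℝ) (y : Fin K → Fin J → ℝ),
        (∀ k, 0 ≤ v k) ∧ (∀ k j, 0 ≤ y k j) ∧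
        (∀ k, z' k + ∑ j, (pr j / β) * y k j ≤ z + v k) ∧
        (∀ k j, a k j ≤ z' k + y k j) ∧
        t = z + ∑ k, (w k / r) * v k}
      h := by
  have : Nonempty (Fin K) := ⟨⟨0, hK⟩⟩
  have : Nonempty (Fin J) := ⟨⟨0, hJ⟩⟩
  choose t ht using fun k =>
    exists_isGreatest_tailAverageValues pr (a k) hpr0 hβ0 (hβ1.trans_eq hpr1.symm)
  have hg : ∀ k, gk k = t k + ∑ j, (pr j / β) * max (a k j - t k) 0 := fun k => by
    rw [hgk]
    exact (ht k).csSup_eq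
  obtain ⟨z, hz⟩ := exists_isGreatest_tailAverageValues w gk hw0 hr0 (hr1.trans_eq hw1.symm)
  have hval : h = z + ∑ k, (w k / r) * max (gk k - z) 0 := hh.trans hz.csSup_eq
  constructor
  · refine ⟨z, fun k => max (gk k - z) 0, t, fun k j => max (a k j - t k) 0,
      fun k => le_max_right _ _, fun k j => le_max_right _ _, fun k => ?_, fun k j => ?_, hval⟩
    · rw [← hg]
      linarith [le_max_left (gk k - z) 0]
    · linarith [le_max_left (a k j - t k) 0]
  · rintro _ ⟨ζ, v, z', y, hv, hy, hzv, hay, rfl⟩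
    rw [hval]
    refine tailAverageValues_le hr0 hz.1 hv fun k => ?_
    rw [hg]
    exact (tailAverageValues_le hβ0 (ht k).1 (hy k) (hay k)).trans (hzv k)
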